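/- Let (R, m, k) be a commutative noetherian local ring and M an R-module. If Ext^n_R(k, M) = 0 for some integer n ≥ depth R + 1, then Ext^i_R(k, M) = 0 for every i in the range depth R + 1 ≤ i ≤ n. -/

import Mathlib

open CategoryTheory Opposite

noncomputable section

/-- The `n`-th Ext group of `R`-modules `X` and `M`, i.e. `Ext^n_R(X, M)`. -/
def extModule (R : Type) [CommRing R] (n : ℕ) (X M : ModuleCat R) : ModuleCat R :=
  ((Ext R (ModuleCat R) n).obj (op X)).obj M

/-- The `n`-th Tor group of `R`-modules `X` and `M`, i.e. `Tor_n^R(X, M)`. -/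
def torModule (R : Type) [CommRing R] (n : ℕ) (X M : ModuleCat R) : ModuleCat R :=
  ((Tor (ModuleCat R) n).obj X).obj M

/-- The residue field `k(p) = R_p / p R_p` at a prime ideal `p`. -/
abbrev resField (R : Type) [CommRing R] (p : Ideal R) [p.IsPrime] : Type :=
  IsLocalRing.ResidueField (Localization.AtPrime p)

/-- `depth_R M := inf{ i : Ext^i_R(k, M) ≠ 0 }`, as an extended real (`⊤ = ∞` if all vanish). -/
noncomputable def edepth (R : Type) [CommRing R] (k M : ModuleCat R) : EReal :=
  sInf {x : EReal | ∃ i : ℕ, x = (i : EReal) ∧ Nontrivial (extModule R i k M)}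

/-- `width_R M := inf{ i : Tor_i^R(k, M) ≠ 0 }`, as an extended real (`⊤ = ∞` if all vanish). -/
noncomputable def ewidth (R : Type) [CommRing R] (k M : ModuleCat R) : EReal :=
  sInf {x : EReal | ∃ i : ℕ, x = (i : EReal) ∧ Nontrivial (torModule R i k M)}

/-- `sup{ i : Ext^i_R(k, M) ≠ 0 }`, as an extended real (`⊥ = -∞` if all vanish). -/
noncomputable def extSup (R : Type) [CommRing R] (k M : ModuleCat R) : EReal :=
  sSup {x : EReal | ∃ i : ℕ, x = (i : EReal) ∧ Nontrivial (extModule R i k M)}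

/-- `sup{ i : Tor_i^R(k, M) ≠ 0 }`, as an extended real (`⊥ = -∞` if all vanish). -/
noncomputable def torSup (R : Type) [CommRing R] (k M : ModuleCat R) : EReal :=
  sSup {x : EReal | ∃ i : ℕ, x = (i : EReal) ∧ Nontrivial (torModule R i k M)}

open CategoryTheory.Abelian IsLocalRing

/-- `Ext^n_R(X, Y)` vanishes iff every `n`-cocycle of `Hom_R(P, Y)` is a coboundary, where `P` is a
projective resolution of `X`. -/
theorem subsingleton_extModule_iff {R : Type} [CommRing R] {X : ModuleCat R}
    (P : ProjectiveResolution X) (Y : ModuleCat R) {p n : ℕ}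
    (hp : (ComplexShape.up ℕ).prev n = p) :
    Subsingleton (extModule R n X Y) ↔
      ∀ f : P.complex.X n ⟶ Y, P.complex.d (n + 1) n ≫ f = 0 →
        ∃ g : P.complex.X p ⟶ Y, P.complex.d n p ≫ g = f := by
  rw [← ModuleCat.isZero_iff_subsingleton]
  have e : extModule R n X Y ≅ (P.complex.linearYonedaObj R Y).homology n := P.isoExt n Y
  rw [e.isZero_iff, ← HomologicalComplex.exactAt_iff_isZero_homology,
    HomologicalComplex.exactAt_iff' _ p n (n + 1) hp (by simp), ShortComplex.moduleCat_exact_iff]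
  exact Iff.rfl

theorem subsingleton_extModule_zero {R : Type} [CommRing R] {X Y : ModuleCat R}
    (h : Subsingleton (Ext X Y 0)) : Subsingleton (extModule R 0 X Y) := by
  have P := projectiveResolution X
  rw [subsingleton_extModule_iff P Y (p := 0) (by simp)]
  intro f hf
  have : Subsingleton (X ⟶ Y) := Ext.homEquiv₀.symm.subsingleton
  let g : ((ChainComplex.single₀ (ModuleCat R)).obj X).X 0 ⟶ Y :=
    P.isColimitCokernelCofork.desc (Limits.CokernelCofork.ofπ f hf)
  have hg : P.π.f 0 ≫ g = f :=
    P.isColimitCokernelCofork.fac (Limits.CokernelCofork.ofπ f hf) Limits.WalkingParallelPair.one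
  have hg0 : g = 0 := Subsingleton.elim (α := X ⟶ Y) g 0
  exact ⟨0, by rw [Limits.comp_zero, ← hg, hg0, Limits.comp_zero]⟩

theorem subsingleton_extModule_succ_iff {R : Type} [CommRing R] {X Y : ModuleCat R} {n : ℕ} :
    Subsingleton (extModule R (n + 1) X Y) ↔ Subsingleton (Ext X Y (n + 1)) := by
  have P := projectiveResolution X
  rw [subsingleton_extModule_iff P Y (p := n) (by simp)]
  refine ⟨fun h ↦ subsingleton_of_forall_eq 0 fun α ↦ ?_, fun h f hf ↦ ?_⟩
  · obtain ⟨f, hf, rfl⟩ := P.extMk_surjective α (n + 2) rfl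
    exact (P.extMk_eq_zero_iff f (n + 2) rfl hf n rfl).2 (h f hf)
  · exact (P.extMk_eq_zero_iff f (n + 2) rfl hf n rfl).1 (Subsingleton.elim _ _)

/-- If `x` annihilates `K` and is regular on `N`, then `Ext^{d+1}(K, N) ≠ 0` implies
`Ext^d(K, N/xN) ≠ 0`. -/
theorem nontrivial_ext_of_smulShortComplex {R : Type} [CommRing R] {K N : ModuleCat R} {x : R}
    (reg : IsSMulRegular N x) (hx : x ∈ Module.annihilator R K) {d : ℕ}
    (h : Nontrivial (Ext K N (d + 1))) : Nontrivial (Ext K (N.smulShortComplex x).X₃ d) := by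
  by_contra! h1
  obtain ⟨α, hα⟩ := exists_ne (0 : Ext K N (d + 1))
  have h0 : α.comp (Ext.mk₀ (N.smulShortComplex x).f) (add_zero (d + 1)) = 0 :=
    congr($(Ext.postcomp_smul_id_eq_zero_of_mem_annihilator (M := N) hx (d + 1)).hom α)
  obtain ⟨β, hβ⟩ := Ext.covariant_sequence_exact₁ K reg.smulShortComplex_shortExact α h0 rfl
  obtain rfl := Subsingleton.elim β 0
  exact hα (hβ.symm.trans (Ext.zero_comp ..))

/-- If `Ext^d(k, N) ≠ 0` for a finite module `N` of projective dimension less than `c`, then `k`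
maps nontrivially to a finite module of projective dimension less than `c + d`. -/
theorem exists_finite_hom_ne_zero_of_nontrivial_ext {R : Type} [CommRing R] [IsNoetherianRing R]
    [IsLocalRing R] {d c : ℕ} {N : ModuleCat R} [Module.Finite R N]
    [HasProjectiveDimensionLT N c]
    (h : Nontrivial (Ext (ModuleCat.of R (ResidueField R)) N d)) :
    ∃ Q : ModuleCat R, Module.Finite R Q ∧ HasProjectiveDimensionLT Q (c + d) ∧
      ∃ f : ModuleCat.of R (ResidueField R) ⟶ Q, f ≠ 0 := by
  induction d generalizing c N with
  | zero =>
    have : Nontrivial (ModuleCat.of R (ResidueField R) ⟶ N) := Ext.homEquiv₀.symm.nontrivial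
    exact ⟨N, ‹_›, ‹_›, exists_ne 0⟩
  | succ d ih =>
    by_cases h0 : Subsingleton (ResidueField R →ₗ[R] N)
    · obtain ⟨x, hx, reg⟩ := IsSMulRegular.subsingleton_linearMap_iff.1 h0
      have hS := reg.smulShortComplex_shortExact
      have hN : HasProjectiveDimensionLT (N.smulShortComplex x).X₂ (c + 1) :=
        hasProjectiveDimensionLT_of_ge N c (c + 1) (Nat.le_succ c)
      have hQ : HasProjectiveDimensionLT (N.smulShortComplex x).X₃ (c + 1) :=
        hS.hasProjectiveDimensionLT_X₃ c ‹_› hN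
      have : Module.Finite R (N.smulShortComplex x).X₃ :=
        inferInstanceAs (Module.Finite R (QuotSMulTop x N))
      rw [show c + (d + 1) = c + 1 + d by lia]
      exact ih (N := (N.smulShortComplex x).X₃) (nontrivial_ext_of_smulShortComplex reg hx h)
    · obtain ⟨f, hf⟩ := @exists_ne _ (not_subsingleton_iff_nontrivial.1 h0) 0
      have := hasProjectiveDimensionLT_of_ge N c (c + (d + 1)) (by lia)
      exact ⟨N, ‹_›, this, ModuleCat.ofHom f, fun h ↦ hf (congr($(h).hom))⟩

/-- If `Ext^n(k, M) = 0`, then `Ext^n(L, M) = 0` for every finite module `L` annihilated by a power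
of the maximal ideal. -/
theorem subsingleton_ext_of_maximalIdeal_pow_le_annihilator {R : Type} [CommRing R] [IsNoetherianRing R]
    [IsLocalRing R] {M : ModuleCat R} {n : ℕ}
    (h : Subsingleton (Ext (ModuleCat.of R (ResidueField R)) M n)) (t : ℕ)
    (L : ModuleCat R) [hL : Module.Finite R L]
    (ht : maximalIdeal R ^ t ≤ Module.annihilator R L) :
    Subsingleton (Ext L M n) := by
  obtain ⟨L, _, _⟩ := L
  change Subsingleton (Ext (ModuleCat.of R L) M n)
  change Module.Finite R L at hL
  change _ ≤ Module.annihilator R L at ht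
  revert ht
  induction hL using IsNoetherianRing.induction_on_isQuotientEquivQuotientPrime R with
  | subsingleton N =>
    intro _
    have hN : Limits.IsZero (ModuleCat.of R N) := ModuleCat.isZero_of_subsingleton _
    refine subsingleton_of_forall_eq 0 fun α ↦ ?_
    rw [← α.mk₀_id_comp, hN.eq_of_src (𝟙 _) 0, Ext.mk₀_zero, Ext.zero_comp]
  | quotient N p e =>
    intro ht
    rw [e.annihilator_eq, Ideal.annihilator_quotient] at ht
    have hp : p.1 = maximalIdeal R :=
      le_antisymm (le_maximalIdeal p.2.ne_top) (p.2.le_of_pow_le ht)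
    rw [hp] at e
    have e' : ModuleCat.of R N ≅ ModuleCat.of R (ResidueField R) := e.toModuleIso
    refine subsingleton_of_forall_eq 0 fun α ↦ ?_
    rw [← α.mk₀_id_comp, ← e'.hom_inv_id, ← Ext.mk₀_comp_mk₀, Ext.comp_assoc_of_second_deg_zero,
      Subsingleton.elim (Ext.comp _ α _) 0, Ext.comp_zero]
  | exact N₁ N₂ N₃ f g hf hg hfg h₁ h₃ =>
    intro ht
    have := h₁ (ht.trans (f.annihilator_le_of_injective hf))
    have := h₃ (ht.trans (g.annihilator_le_of_surjective hg))
    have hS := ModuleCat.shortComplex_shortExact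
      (ModuleCat.shortComplexOfCompEqZero f g hfg.linearMap_comp_eq_zero) hfg hf hg
    refine subsingleton_of_forall_eq 0 fun α ↦ ?_
    obtain ⟨β, rfl⟩ := Ext.contravariant_sequence_exact₂ hS M α (Subsingleton.elim _ _)
    rw [Subsingleton.elim β 0, Ext.comp_zero]

/-- If `k` maps nontrivially to a finite module of projective dimension less than `n`, then
`Ext^{n+1}(k, M) = 0` implies `Ext^n(k, M) = 0`. -/
theorem subsingleton_ext_residueField_of_succ {R : Type} [CommRing R] [IsNoetherianRing R]
    [IsLocalRing R] {Q M : ModuleCat R} [Module.Finite R Q] {n : ℕ}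
    [HasProjectiveDimensionLT Q n]
    {f : ModuleCat.of R (ResidueField R) ⟶ Q} (hf : f ≠ 0)
    (h : Subsingleton (Ext (ModuleCat.of R (ResidueField R)) M (n + 1))) :
    Subsingleton (Ext (ModuleCat.of R (ResidueField R)) M n) := by
  obtain ⟨t, ht⟩ : ∃ t : ℕ, ¬ LinearMap.range f.hom ≤ maximalIdeal R ^ t • (⊤ : Submodule R Q) := by
    by_contra! H
    have := le_iInf H
    rw [Ideal.iInf_pow_smul_eq_bot_of_isLocalRing _ (maximalIdeal.isMaximal R).ne_top, le_bot_iff,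
      LinearMap.range_eq_bot] at this
    exact hf (ModuleCat.hom_ext this)
  let L := Q ⧸ (maximalIdeal R ^ t • (⊤ : Submodule R Q))
  let π : Q ⟶ ModuleCat.of R L := ModuleCat.ofHom (Submodule.mkQ _)
  let g : ResidueField R →ₗ[R] L := (f ≫ π).hom
  have hg : Function.Injective g := by
    have : IsSimpleModule R (ResidueField R) :=
      isSimpleModule_iff_quot_maximal.2 ⟨_, maximalIdeal.isMaximal R, ⟨LinearEquiv.refl R _⟩⟩
    refine (LinearMap.injective_or_eq_zero g).resolve_right fun h0 ↦ ht ?_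
    rintro _ ⟨x, rfl⟩
    exact (Submodule.Quotient.mk_eq_zero _).1 congr($h0 x)
  let S := ModuleCat.shortComplexOfCompEqZero g (LinearMap.range g).mkQ
    (LinearMap.exact_map_mkQ_range g).linearMap_comp_eq_zero
  have hS : S.ShortExact := ModuleCat.shortComplex_shortExact S
    (LinearMap.exact_map_mkQ_range g) hg (Submodule.mkQ_surjective _)
  have hC : Subsingleton (Ext S.X₃ M (n + 1)) := by
    have : Module.Finite R S.X₃ := inferInstanceAs (Module.Finite R (L ⧸ LinearMap.range g))
    refine subsingleton_ext_of_maximalIdeal_pow_le_annihilator h t _ ?_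
    refine le_trans ?_ ((LinearMap.range g).mkQ.annihilator_le_of_surjective
      (Submodule.mkQ_surjective _))
    intro r hr
    rw [Module.mem_annihilator]
    rintro ⟨q⟩
    exact (Submodule.Quotient.mk_eq_zero _).2 (Submodule.smul_mem_smul hr trivial)
  refine subsingleton_of_forall_eq 0 fun α ↦ ?_
  obtain ⟨β, rfl⟩ := Ext.contravariant_sequence_exact₁ hS M α (add_comm 1 n) (Subsingleton.elim _ _)
  have : (Ext.mk₀ π).comp β (zero_add n) = 0 := Ext.eq_zero_of_hasProjectiveDimensionLT _ n le_rfl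
  change (Ext.mk₀ (f ≫ π)).comp β (zero_add n) = 0
  rw [← Ext.mk₀_comp_mk₀, Ext.comp_assoc_of_second_deg_zero, this, Ext.comp_zero]

theorem exists_lt_of_edepth_add_one_le {R : Type} [CommRing R] {k M : ModuleCat R} {n : ℕ}
    (h : edepth R k M + 1 ≤ (n : EReal)) :
    ∃ d < n, Nontrivial (extModule R d k M) := by
  by_contra! H
  have h1 : (n : EReal) ≤ edepth R k M := by
    refine le_sInf ?_
    rintro _ ⟨d, rfl, hd⟩
    refine Nat.cast_le.2 (not_lt.1 fun hlt ↦ ?_)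
    exact not_subsingleton _ (H d hlt)
  have h2 : ((n : EReal) + 1) ≤ n := (add_le_add_left h1 1).trans h
  exact absurd h2 (by exact_mod_cast Nat.not_succ_le_self n)

/-- `(R, m, k)` local noetherian. If `Ext^n_R(k, M) = 0` for some
`n ≥ depth R + 1`, then `Ext^i_R(k, M) = 0` for every `i` with `depth R + 1 ≤ i ≤ n`. -/
theorem ext_vanishing_range_above_depth
    (R : Type) [CommRing R] [IsNoetherianRing R] [IsLocalRing R]
    (M : Type) [AddCommGroup M] [Module R M] (n : ℕ)
    (hn : edepth R (ModuleCat.of R (IsLocalRing.ResidueField R)) (ModuleCat.of R R) + 1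
      ≤ (n : EReal))
    (hvan : Subsingleton (extModule R n
      (ModuleCat.of R (IsLocalRing.ResidueField R)) (ModuleCat.of R M))) :
    ∀ i : ℕ,
      edepth R (ModuleCat.of R (IsLocalRing.ResidueField R)) (ModuleCat.of R R) + 1
        ≤ (i : EReal) → i ≤ n →
      Subsingleton (extModule R i
        (ModuleCat.of R (IsLocalRing.ResidueField R)) (ModuleCat.of R M)) := by
  intro i hi hin
  obtain ⟨d, hdi, hd⟩ := exists_lt_of_edepth_add_one_le hi
  have hd' : Nontrivial (Ext (ModuleCat.of R (ResidueField R)) (ModuleCat.of R R) d) := by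
    by_contra! H
    refine not_subsingleton (extModule R d (ModuleCat.of R (ResidueField R)) (ModuleCat.of R R)) ?_
    cases d with
    | zero => exact subsingleton_extModule_zero H
    | succ d => exact subsingleton_extModule_succ_iff.2 H
  have : Projective (ModuleCat.of R R) := ModuleCat.projective_of_free (Module.Basis.singleton Unit R)
  obtain ⟨Q, _, _, f, hf⟩ := exists_finite_hom_ne_zero_of_nontrivial_ext (c := 1) hd'
  induction hin using Nat.decreasingInduction with
  | self => exact hvan
  | of_succ j hj ih =>
    obtain ⟨j, rfl⟩ := Nat.exists_eq_add_one_of_ne_zero (Nat.ne_zero_of_lt hdi)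
    have := hasProjectiveDimensionLT_of_ge Q (1 + d) (j + 1) (by lia)
    exact subsingleton_extModule_succ_iff.2 (subsingleton_ext_residueField_of_succ hf
      (subsingleton_extModule_succ_iff.1 (ih (hi.trans (by norm_cast; lia)) (by lia))))
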